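/- arXiv:1708.07179 — 2 statements merged into one kernel-verified Lean document; each statement's English description precedes it below -/
import Mathlib

section
/- For every ℓ ≥ 1 and every n ≥ 4, the ℓ-visibility cop number of the cycle C_n equals 2. -/
namespace CopsRobber

open Classical

noncomputable section

variable {V : Type*}

/-- Observation available to the cops: the robber's position is revealed iff some cop
is within graph distance `ℓ` of the robber. -/
def obs (G : SimpleGraph V) (ℓ : ℕ∞) {k : ℕ} (p : Fin k → V) (r : V) : Option V :=
  if ∃ i, (G.dist (p i) r : ℕ∞) ≤ ℓ then some r else none

/-- A strategy for `k` cops on `G`: initial positions, and a move function depending on the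
history of observations and the current cop positions.  Each cop moves along an edge or
passes. -/
structure CopStrategy (G : SimpleGraph V) (k : ℕ) where
  init : Fin k → V
  move : List (Option V) → (Fin k → V) → Fin k → V
  valid : ∀ h p i, move h p i = p i ∨ G.Adj (p i) (move h p i)

/-- A robber trajectory: in each round the robber moves along an edge or passes. -/
def RobberWalk (G : SimpleGraph V) (R : ℕ → V) : Prop :=
  ∀ t, R (t + 1) = R t ∨ G.Adj (R t) (R (t + 1))

/-- The play of the game: cop positions and observation history at the end of each round.
In round `t+1` the cops move first (observing the robber at his position of round `t` if
within range), then the robber moves (and is observed at his new position if within range). -/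
def play (G : SimpleGraph V) (ℓ : ℕ∞) {k : ℕ} (σ : CopStrategy G k) (R : ℕ → V) :
    ℕ → (Fin k → V) × List (Option V)
  | 0 => (σ.init, [obs G ℓ σ.init (R 0)])
  | t + 1 =>
    let s := play G ℓ σ R t
    let p := σ.move s.2 s.1
    (p, (s.2 ++ [obs G ℓ p (R t)]) ++ [obs G ℓ p (R (t + 1))])

/-- Positions of the cops at the end of round `t`. -/
def copsAt (G : SimpleGraph V) (ℓ : ℕ∞) {k : ℕ} (σ : CopStrategy G k) (R : ℕ → V)
    (t : ℕ) : Fin k → V :=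
  (play G ℓ σ R t).1

/-- The cops capture the robber: some cop occupies the robber's vertex, either
simultaneously or by moving onto it mid-round. -/
def Captures (G : SimpleGraph V) (ℓ : ℕ∞) {k : ℕ} (σ : CopStrategy G k) (R : ℕ → V) : Prop :=
  ∃ t i, copsAt G ℓ σ R t i = R t ∨ copsAt G ℓ σ R (t + 1) i = R t

/-- The cops see the robber: some cop comes within distance `ℓ` of the robber. -/
def Sees (G : SimpleGraph V) (ℓ : ℕ∞) {k : ℕ} (σ : CopStrategy G k) (R : ℕ → V) : Prop :=
  ∃ t i, (G.dist (copsAt G ℓ σ R t i) (R t) : ℕ∞) ≤ ℓ ∨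
    (G.dist (copsAt G ℓ σ R (t + 1) i) (R t) : ℕ∞) ≤ ℓ

/-- `c_ℓ(G)`: the minimum number of cops that guarantee capture of the robber in the
`ℓ`-visibility Cops and Robber game. -/
def visCopNumber (G : SimpleGraph V) (ℓ : ℕ∞) : ℕ :=
  sInf {k | ∃ σ : CopStrategy G k, ∀ R, RobberWalk G R → Captures G ℓ σ R}

/-- `c'_ℓ(G)`: the minimum number of cops that guarantee seeing the robber in the
`ℓ`-visibility Cops and Robber game. -/
def visSeeNumber (G : SimpleGraph V) (ℓ : ℕ∞) : ℕ :=
  sInf {k | ∃ σ : CopStrategy G k, ∀ R, RobberWalk G R → Sees G ℓ σ R}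

/-- The classical cop number: the game with full visibility. -/
def copNumber (G : SimpleGraph V) : ℕ := visCopNumber G ⊤

end
end CopsRobber


namespace CopsRobber

open SimpleGraph

variable {V : Type*}

/-- A robber who answers the cops by `f`: his position together with the cop positions and the
observation history at the end of each round. -/
noncomputable def evasion (G : SimpleGraph V) (ℓ : ℕ∞) {k : ℕ} (σ : CopStrategy G k) (r₀ : V)
    (f : (Fin k → V) → V → V) : ℕ → V × (Fin k → V) × List (Option V)
  | 0 => (r₀, σ.init, [obs G ℓ σ.init r₀])
  | t + 1 =>
    let s := evasion G ℓ σ r₀ f t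
    let p := σ.move s.2.2 s.2.1
    (f p s.1, p, (s.2.2 ++ [obs G ℓ p s.1]) ++ [obs G ℓ p (f p s.1)])

theorem play_evasion (G : SimpleGraph V) (ℓ : ℕ∞) {k : ℕ} (σ : CopStrategy G k) (r₀ : V)
    (f : (Fin k → V) → V → V) (t : ℕ) :
    play G ℓ σ (fun t => (evasion G ℓ σ r₀ f t).1) t = (evasion G ℓ σ r₀ f t).2 := by
  induction t with
  | zero => rfl
  | succ t ih => simp only [play, ih, evasion]

theorem not_captures_zero (G : SimpleGraph V) (ℓ : ℕ∞) (σ : CopStrategy G 0) (R : ℕ → V) :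
    ¬ Captures G ℓ σ R := by
  rintro ⟨t, i, -⟩
  exact i.elim0

/-- A robber who can always step out of the closed neighborhood of a single cop evades him. -/
theorem exists_robberWalk_not_captures_one (G : SimpleGraph V) (ℓ : ℕ∞) (σ : CopStrategy G 1)
    (hstart : ∀ c, ∃ r, r ≠ c ∧ ¬ G.Adj c r)
    (hstep : ∀ c r, r ≠ c → ∃ r', (r' = r ∨ G.Adj r r') ∧ r' ≠ c ∧ ¬ G.Adj c r') :
    ∃ R, RobberWalk G R ∧ ¬ Captures G ℓ σ R := by
  have hf : ∀ c r, ∃ r', (r' = r ∨ G.Adj r r') ∧ (r ≠ c → r' ≠ c ∧ ¬ G.Adj c r') := by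
    intro c r
    by_cases h : r = c
    · exact ⟨r, Or.inl rfl, fun h' => absurd h h'⟩
    · obtain ⟨r', h₁, h₂⟩ := hstep c r h
      exact ⟨r', h₁, fun _ => h₂⟩
  choose f hwalk hfar using hf
  obtain ⟨r₀, hr₀⟩ := hstart (σ.init 0)
  let S := evasion G ℓ σ r₀ fun p r => f (p 0) r
  have hmove : ∀ t, (S t).1 ≠ (S t).2.1 0 → ¬ G.Adj ((S t).2.1 0) (S t).1 →
      (S t).1 ≠ (S (t + 1)).2.1 0 := by
    intro t h₁ h₂ h
    change (S t).1 = σ.move (S t).2.2 (S t).2.1 0 at h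
    rcases σ.valid (S t).2.2 (S t).2.1 0 with h' | h'
    · exact h₁ (h.trans h')
    · exact h₂ (h ▸ h')
  have hinv : ∀ t, (S t).1 ≠ (S t).2.1 0 ∧ ¬ G.Adj ((S t).2.1 0) (S t).1 := by
    intro t
    induction t with
    | zero => exact hr₀
    | succ t ih => exact hfar _ _ (hmove t ih.1 ih.2)
  refine ⟨fun t => (S t).1, fun t => hwalk _ _, ?_⟩
  rintro ⟨t, i, h⟩
  obtain rfl : i = 0 := Subsingleton.elim _ _
  simp only [copsAt, S, play_evasion] at h
  rcases h with h | h
  · exact (hinv t).1 h.symm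
  · exact hmove t (hinv t).1 (hinv t).2 h.symm

theorem cycleGraph_exists_step_away {m : ℕ} (c r : Fin (m + 4)) (h : r ≠ c) :
    ∃ r', (r' = r ∨ (cycleGraph (m + 4)).Adj r r') ∧
      r' ≠ c ∧ ¬ (cycleGraph (m + 4)).Adj c r' := by
  have h01 : (1 : Fin (m + 4)) ≠ 0 := by simp
  have h2 : (1 + 1 : Fin (m + 4)) ≠ 0 := by
    simp [Fin.ext_iff, Fin.val_add, Nat.mod_eq_of_lt (show 2 < m + 4 by omega)]
  have h3 : (1 + 1 + 1 : Fin (m + 4)) ≠ 0 := by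
    simp [Fin.ext_iff, Fin.val_add, Nat.mod_eq_of_lt (show 3 < m + 4 by omega)]
  simp only [cycleGraph_adj]
  by_cases h₁ : r - c = 1
  · obtain rfl : r = c + 1 := by rw [← h₁]; abel
    refine ⟨c + 1 + 1, Or.inr (Or.inr (by abel)), fun e => h2 ?_, ?_⟩
    · rwa [add_assoc, add_eq_left] at e
    · rintro (e | e)
      · apply h3
        rw [show c - (c + 1 + 1) = -(1 + 1) by abel] at e
        nth_rw 3 [← e]
        abel
      · rw [show c + 1 + 1 - c = 1 + 1 by abel, add_eq_left] at e
        exact h01 e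
  by_cases h₂ : c - r = 1
  · obtain rfl : c = r + 1 := by rw [← h₂]; abel
    refine ⟨r - 1, Or.inr (Or.inl (by abel)), fun e => h2 ?_, ?_⟩
    · rw [sub_eq_iff_eq_add, add_assoc, eq_comm, add_eq_left] at e
      exact e
    · rintro (e | e)
      · rw [show r + 1 - (r - 1) = 1 + 1 by abel, add_eq_left] at e
        exact h01 e
      · apply h3
        rw [show r - 1 - (r + 1) = -(1 + 1) by abel] at e
        nth_rw 3 [← e]
        abel
  · exact ⟨r, Or.inl rfl, h, by tauto⟩

/-- Two cops sweep a cycle by walking in opposite directions from a common vertex. -/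
def sweep (m : ℕ) : CopStrategy (cycleGraph (m + 4)) 2 where
  init := fun _ => 0
  move := fun _ p => ![p 0 + 1, p 1 - 1]
  valid := by
    intro h p i
    right
    fin_cases i <;> simp [cycleGraph_adj]

theorem copsAt_sweep (m : ℕ) (ℓ : ℕ∞) (R : ℕ → Fin (m + 4)) (t : ℕ) :
    copsAt (cycleGraph (m + 4)) ℓ (sweep m) R t = ![Fin.ofNat _ t, -Fin.ofNat _ t] := by
  induction t with
  | zero => ext i; fin_cases i <;> simp [copsAt, play, sweep]
  | succ t ih =>
    have hcast : Fin.ofNat (m + 4) (t + 1) = Fin.ofNat (m + 4) t + 1 := by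
      ext; simp [Fin.val_add]
    change (sweep m).move (play _ ℓ (sweep m) R t).2 (copsAt _ ℓ (sweep m) R t) = _
    rw [ih, hcast]
    simp only [sweep, Matrix.cons_val_zero, Matrix.cons_val_one, neg_add, sub_eq_add_neg]

theorem sweep_captures (m : ℕ) (ℓ : ℕ∞) (R : ℕ → Fin (m + 4))
    (hR : RobberWalk (cycleGraph (m + 4)) R) :
    Captures (cycleGraph (m + 4)) ℓ (sweep m) R := by
  by_contra hcap
  have hl : ∀ t s, s = t ∨ s = t + 1 → s < m + 4 →
      (R t).val ≠ s ∧ (R t).val + s ≠ m + 4 := by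
    intro t s hs hsm
    have key : ∀ i, ![Fin.ofNat (m + 4) s, -Fin.ofNat (m + 4) s] i ≠ R t := by
      intro i h
      refine hcap ⟨t, i, ?_⟩
      rcases hs with rfl | rfl
      · left; rwa [copsAt_sweep]
      · right; rwa [copsAt_sweep]
    refine ⟨fun h => key 0 ?_, fun h => key 1 ?_⟩
    · ext
      simp [h, Nat.mod_eq_of_lt hsm]
    · simp only [Matrix.cons_val_one, Matrix.cons_val_fin_one]
      rw [neg_eq_iff_add_eq_zero]
      ext
      simp [Fin.val_add, add_comm s, h]
  have hinv : ∀ t, t < (R t).val ∧ (R t).val + t < m + 4 := by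
    intro t
    induction t with
    | zero =>
      have h₁ := hl 0 0 (Or.inl rfl) (by omega)
      have h₂ := (R 0).isLt
      omega
    | succ t ih =>
      have h₁ := hl t (t + 1) (Or.inr rfl) (by omega)
      have h₂ := hl (t + 1) (t + 1) (Or.inl rfl) (by omega)
      have h₃ : (R (t + 1)).val ≤ (R t).val + 1 ∧ (R t).val ≤ (R (t + 1)).val + 1 := by
        have hone : ((1 : Fin (m + 4)) : ℕ) = 1 := rfl
        rcases hR t with h | h
        · rw [h]; omega
        · rw [cycleGraph_adj] at h
          rcases h with h | h
          · have := congrArg Fin.val (sub_eq_iff_eq_add'.mp h)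
            rw [Fin.val_add, hone] at this
            by_cases hlt : (R (t + 1)).val + 1 < m + 4
            · rw [Nat.mod_eq_of_lt hlt] at this
              omega
            · rw [show (R (t + 1)).val + 1 = m + 4 by omega, Nat.mod_self] at this
              omega
          · have := congrArg Fin.val (sub_eq_iff_eq_add'.mp h)
            rw [Fin.val_add, hone, Nat.mod_eq_of_lt (by omega)] at this
            omega
      omega
  have := hinv (m + 4)
  omega

end CopsRobber

open CopsRobber in
/-- For every `ℓ ≥ 1` and `n ≥ 4`, `c_ℓ(C_n) = 2`. -/
theorem visCopNumber_cycle (ℓ n : ℕ) (hℓ : 1 ≤ ℓ) (hn : 4 ≤ n) :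
    visCopNumber (SimpleGraph.cycleGraph n) (ℓ : ℕ∞) = 2 := by
  obtain ⟨m, rfl⟩ := Nat.exists_eq_add_of_le' hn
  have hmem : 2 ∈ {k | ∃ σ : CopStrategy (SimpleGraph.cycleGraph (m + 4)) k,
      ∀ R, RobberWalk _ R → Captures _ (ℓ : ℕ∞) σ R} := ⟨sweep m, sweep_captures m ℓ⟩
  refine le_antisymm (Nat.sInf_le hmem) (le_csInf ⟨2, hmem⟩ ?_)
  rintro k ⟨σ, hσ⟩
  by_contra! hk
  interval_cases k
  · exact not_captures_zero _ _ σ _ (hσ (fun _ => 0) fun _ => Or.inl rfl)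
  · obtain ⟨R, hR, hcap⟩ := exists_robberWalk_not_captures_one _ ℓ σ
      (fun c => ((cycleGraph_exists_step_away c (c + 1) (by simp)).imp fun _ h => h.2))
      cycleGraph_exists_step_away
    exact hcap (hσ R hR)
end

section
/- For any connected graph G and ℓ ≥ 2, either c'_ℓ(G) = c_ℓ(G), or c(G) ≤ c_ℓ(G) ≤ c(G) + 1. -/
namespace CopsRobber

section Helpers

variable {V : Type*} {G : SimpleGraph V} {ℓ : ℕ∞} {k : ℕ}

lemma obs_eq_some {p : Fin k → V} {r : V} {i : Fin k} (h : (G.dist (p i) r : ℕ∞) ≤ ℓ) :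
    obs G ℓ p r = some r :=
  if_pos ⟨i, h⟩

/-- A robber within range of some cop is located exactly by the observation. -/
lemma eq_of_obs_eq {p : Fin k → V} {r r' : V} {i : Fin k}
    (h : (G.dist (p i) r : ℕ∞) ≤ ℓ) (he : obs G ℓ p r = obs G ℓ p r') : r = r' := by
  rw [obs_eq_some h] at he
  unfold obs at he
  split_ifs at he
  exact Option.some.inj he

lemma RobberWalk.shift {R : ℕ → V} (h : RobberWalk G R) (T : ℕ) :
    RobberWalk G fun u => R (T + u) :=
  fun t => h (T + t)

lemma RobberWalk.dist_succ_le_one {R : ℕ → V} (h : RobberWalk G R) (t : ℕ) :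
    G.dist (R t) (R (t + 1)) ≤ 1 := by
  rcases h t with h | h
  · simp [h]
  · exact (SimpleGraph.dist_eq_one_iff_adj.2 h).le

lemma copsAt_valid (σ : CopStrategy G k) (R : ℕ → V) (t : ℕ) (i : Fin k) :
    copsAt G ℓ σ R (t + 1) i = copsAt G ℓ σ R t i ∨
      G.Adj (copsAt G ℓ σ R t i) (copsAt G ℓ σ R (t + 1) i) :=
  σ.valid _ _ i

lemma play_congr (σ : CopStrategy G k) {R R' : ℕ → V} {t : ℕ} (h : ∀ s ≤ t, R s = R' s) :
    play G ℓ σ R t = play G ℓ σ R' t := by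
  induction t with
  | zero => simp [play, h 0 le_rfl]
  | succ t ih =>
    simp only [play, ih fun s hs => h s (by omega), h t (by omega), h (t + 1) le_rfl]

/-- The observation history when the cops' trajectory is `P`. -/
noncomputable def history (G : SimpleGraph V) (ℓ : ℕ∞) (P : ℕ → Fin k → V) (R : ℕ → V) :
    ℕ → List (Option V)
  | 0 => [obs G ℓ (P 0) (R 0)]
  | t + 1 => (history G ℓ P R t ++ [obs G ℓ (P (t + 1)) (R t)]) ++
      [obs G ℓ (P (t + 1)) (R (t + 1))]

/-- Two plays have the same observations up to the end of round `t`. -/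
def ObsAgree (G : SimpleGraph V) (ℓ : ℕ∞) (P P' : ℕ → Fin k → V) (R R' : ℕ → V) (t : ℕ) :
    Prop :=
  (∀ s ≤ t, obs G ℓ (P s) (R s) = obs G ℓ (P' s) (R' s)) ∧
    ∀ s < t, obs G ℓ (P (s + 1)) (R s) = obs G ℓ (P' (s + 1)) (R' s)

lemma ObsAgree.mono {P P' : ℕ → Fin k → V} {R R' : ℕ → V} {s t : ℕ}
    (h : ObsAgree G ℓ P P' R R' t) (hs : s ≤ t) : ObsAgree G ℓ P P' R R' s :=
  ⟨fun u hu => h.1 u (hu.trans hs), fun u hu => h.2 u (hu.trans_le hs)⟩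

lemma length_history (P : ℕ → Fin k → V) (R : ℕ → V) (t : ℕ) :
    (history G ℓ P R t).length = 2 * t + 1 := by
  induction t with
  | zero => rfl
  | succ t ih => simp only [history, List.length_append, ih, List.length_singleton]; ring

lemma history_eq_iff {P P' : ℕ → Fin k → V} {R R' : ℕ → V} {t : ℕ} :
    history G ℓ P R t = history G ℓ P' R' t ↔ ObsAgree G ℓ P P' R R' t := by
  induction t with
  | zero => simp [history, ObsAgree]
  | succ t ih =>
    have key : history G ℓ P R (t + 1) = history G ℓ P' R' (t + 1) ↔
        (history G ℓ P R t = history G ℓ P' R' t ∧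
          obs G ℓ (P (t + 1)) (R t) = obs G ℓ (P' (t + 1)) (R' t)) ∧
          obs G ℓ (P (t + 1)) (R (t + 1)) = obs G ℓ (P' (t + 1)) (R' (t + 1)) := by
      simp only [history, List.append_singleton_inj]
    rw [key, ih]
    constructor
    · rintro ⟨⟨h, h1⟩, h2⟩
      refine ⟨fun s hs => ?_, fun s hs => ?_⟩
      · rcases hs.lt_or_eq with hs | rfl
        · exact h.1 s (by omega)
        · exact h2
      · rcases (Nat.lt_succ_iff.1 hs).lt_or_eq with hs | rfl
        · exact h.2 s hs
        · exact h1
    · intro h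
      exact ⟨⟨h.mono t.le_succ, h.2 t t.lt_succ_self⟩, h.1 _ le_rfl⟩

lemma play_eq (σ : CopStrategy G k) (R : ℕ → V) (t : ℕ) :
    play G ℓ σ R t = (copsAt G ℓ σ R t, history G ℓ (copsAt G ℓ σ R) R t) := by
  induction t with
  | zero => rfl
  | succ t ih =>
    refine Prod.ext rfl ?_
    have h : history G ℓ (copsAt G ℓ σ R) R t = (play G ℓ σ R t).2 := by rw [ih]
    simp only [history, h]
    rfl

lemma copsAt_eq_of_obsAgree (σ : CopStrategy G k) {R R' : ℕ → V} {t : ℕ}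
    (h : ObsAgree G ℓ (copsAt G ℓ σ R) (copsAt G ℓ σ R') R R' t) :
    copsAt G ℓ σ R t = copsAt G ℓ σ R' t ∧ copsAt G ℓ σ R (t + 1) = copsAt G ℓ σ R' (t + 1) := by
  have step : ∀ t, copsAt G ℓ σ R t = copsAt G ℓ σ R' t →
      ObsAgree G ℓ (copsAt G ℓ σ R) (copsAt G ℓ σ R') R R' t →
      copsAt G ℓ σ R (t + 1) = copsAt G ℓ σ R' (t + 1) := by
    intro t h1 h2
    change σ.move (play G ℓ σ R t).2 (play G ℓ σ R t).1 =
      σ.move (play G ℓ σ R' t).2 (play G ℓ σ R' t).1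
    rw [play_eq, play_eq, h1, history_eq_iff.2 h2]
  induction t with
  | zero => exact ⟨rfl, step 0 rfl h⟩
  | succ t ih =>
    have := (ih (h.mono t.le_succ)).2
    exact ⟨this, step _ this h⟩

/-- A family of cop trajectories, one for each robber trajectory in `A`, comes from a strategy
as soon as it consists of legal moves that depend only on past observations. -/
lemma exists_strategy (A : Set (ℕ → V)) (P : (ℕ → V) → ℕ → Fin k → V) (p : Fin k → V)
    (h0 : ∀ R ∈ A, P R 0 = p)
    (hv : ∀ R ∈ A, ∀ t i, P R (t + 1) i = P R t i ∨ G.Adj (P R t i) (P R (t + 1) i))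
    (hn : ∀ R ∈ A, ∀ R' ∈ A, ∀ t, (∀ s ≤ t, P R s = P R' s) →
      ObsAgree G ℓ (P R) (P R') R R' t → P R (t + 1) = P R' (t + 1)) :
    ∃ σ : CopStrategy G k, σ.init = p ∧ ∀ R ∈ A, ∀ t, copsAt G ℓ σ R t = P R t := by
  classical
  have agree : ∀ R ∈ A, ∀ R' ∈ A, ∀ t, ObsAgree G ℓ (P R) (P R') R R' t →
      ∀ s ≤ t + 1, P R s = P R' s := by
    intro R hR R' hR' t h s
    induction s using Nat.strong_induction_on with
    | _ s ih =>
      intro hs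
      cases s with
      | zero => rw [h0 R hR, h0 R' hR']
      | succ s =>
        exact hn R hR R' hR' s (fun u hu => ih u (by omega) (by omega)) (h.mono (by omega))
  let C : List (Option V) → (Fin k → V) → (ℕ → V) × ℕ → Prop :=
    fun h q x => x.1 ∈ A ∧ history G ℓ (P x.1) x.1 x.2 = h ∧ P x.1 x.2 = q
  let σ : CopStrategy G k :=
    { init := p
      move := fun h q => if H : ∃ x, C h q x then P H.choose.1 (H.choose.2 + 1) else q
      valid := by
        intro h q i
        by_cases H : ∃ x, C h q x
        · rw [dif_pos H]
          have := hv _ H.choose_spec.1 H.choose.2 i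
          rwa [H.choose_spec.2.2] at this
        · rw [dif_neg H]
          exact Or.inl rfl }
  refine ⟨σ, rfl, fun R hR => ?_⟩
  have main : ∀ t, play G ℓ σ R t = (P R t, history G ℓ (P R) R t) := by
    intro t
    induction t with
    | zero => simp [play, history, σ, h0 R hR]
    | succ t ih =>
      have hm : σ.move (history G ℓ (P R) R t) (P R t) = P R (t + 1) := by
        have H : ∃ x, C (history G ℓ (P R) R t) (P R t) x := ⟨(R, t), hR, rfl, rfl⟩
        change (if H : ∃ x, C _ _ x then P H.choose.1 (H.choose.2 + 1) else _) = _
        rw [dif_pos H]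
        obtain ⟨hA, hh, -⟩ := H.choose_spec
        have ht : H.choose.2 = t := by
          have := congrArg List.length hh
          rw [length_history, length_history] at this
          omega
        rw [ht] at hh ⊢
        exact agree _ hA R hR t (history_eq_iff.1 hh) _ le_rfl
      simp only [play, ih, hm, history]
  intro t
  rw [copsAt, main]

/-- The cops may play `σ` until they reach a history from which some strategy captures the
robber, and then switch to that strategy. -/
lemma exists_capturing_of_switch (σ : CopStrategy G k) (A : Set (ℕ → V))
    (h : ∀ R ∈ A, ∃ t, ∃ τ : CopStrategy G k, ∀ R' ∈ A,
      ObsAgree G ℓ (copsAt G ℓ σ R) (copsAt G ℓ σ R') R R' t →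
        τ.init = copsAt G ℓ σ R' t ∧ Captures G ℓ τ fun u => R' (t + u)) :
    ∃ σ' : CopStrategy G k, σ'.init = σ.init ∧ ∀ R ∈ A, Captures G ℓ σ' R := by
  classical
  let H : (ℕ → V) → ℕ → List (Option V) := fun R => history G ℓ (copsAt G ℓ σ R) R
  let Good : ℕ → List (Option V) → CopStrategy G k → Prop := fun t l τ =>
    ∀ R ∈ A, H R t = l → τ.init = copsAt G ℓ σ R t ∧ Captures G ℓ τ fun u => R (t + u)
  let S : (ℕ → V) → Set ℕ := fun R => {t | ∃ τ, Good t (H R t) τ}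
  let T : (ℕ → V) → ℕ := fun R => sInf (S R)
  let τ : ℕ → List (Option V) → CopStrategy G k := fun t l =>
    if h : ∃ τ, Good t l τ then h.choose else σ
  have hT : ∀ R ∈ A, Good (T R) (H R (T R)) (τ (T R) (H R (T R))) := by
    intro R hR
    have hne : (S R).Nonempty := by
      obtain ⟨t, τ', h'⟩ := h R hR
      exact ⟨t, τ', fun R' hR' he => h' R' hR' (history_eq_iff.1 he.symm)⟩
    have hm : ∃ τ, Good (T R) (H R (T R)) τ := Nat.sInf_mem hne
    simp only [τ, dif_pos hm]
    exact hm.choose_spec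
  let P : (ℕ → V) → ℕ → Fin k → V := fun R s =>
    if s ≤ T R then copsAt G ℓ σ R s
    else copsAt G ℓ (τ (T R) (H R (T R))) (fun u => R (T R + u)) (s - T R)
  have P_le : ∀ R s, s ≤ T R → P R s = copsAt G ℓ σ R s := fun R s hs => if_pos hs
  have P_add : ∀ R ∈ A, ∀ u,
      P R (T R + u) = copsAt G ℓ (τ (T R) (H R (T R))) (fun u => R (T R + u)) u := by
    intro R hR u
    cases u with
    | zero =>
      rw [add_zero, P_le R _ le_rfl]
      exact ((hT R hR R hR rfl).1).symm
    | succ u =>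
      simp only [P]
      rw [if_neg (by omega), Nat.add_sub_cancel_left]
  have key : ∀ R ∈ A, ∀ R' ∈ A, ∀ t, ObsAgree G ℓ (P R) (P R') R R' t → T R ≤ T R' →
      P R (t + 1) = P R' (t + 1) := by
    intro R hR R' hR' t ho hle
    have hσ : ∀ u ≤ t, u ≤ T R →
        ObsAgree G ℓ (copsAt G ℓ σ R) (copsAt G ℓ σ R') R R' u := by
      intro u hu huT
      refine ⟨fun s hs => ?_, fun s hs => ?_⟩
      · rw [← P_le R s (by omega), ← P_le R' s (by omega)]
        exact ho.1 s (by omega)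
      · rw [← P_le R (s + 1) (by omega), ← P_le R' (s + 1) (by omega)]
        exact ho.2 s (by omega)
    rcases lt_or_ge t (T R) with ht | ht
    · rw [P_le R _ ht, P_le R' _ (by omega)]
      exact (copsAt_eq_of_obsAgree σ (hσ t le_rfl ht.le)).2
    · have hH : H R (T R) = H R' (T R) := history_eq_iff.2 (hσ _ ht le_rfl)
      have hTT : T R = T R' := by
        refine le_antisymm hle (Nat.sInf_le ⟨τ (T R) (H R (T R)), ?_⟩)
        rw [← hH]
        exact hT R hR
      obtain ⟨u, rfl⟩ := Nat.exists_eq_add_of_le ht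
      have e1 := P_add R hR
      have e2 := P_add R' hR'
      rw [← hTT, ← hH] at e2
      rw [add_assoc, e1, e2]
      refine (copsAt_eq_of_obsAgree _ ⟨fun s hs => ?_, fun s hs => ?_⟩).2
      · rw [← e1, ← e2]
        exact ho.1 _ (by omega)
      · rw [← e1, ← e2]
        exact ho.2 (T R + s) (by omega)
  obtain ⟨σ', h0, hσ'⟩ := exists_strategy (G := G) (ℓ := ℓ) A P σ.init
    (fun R _ => P_le R 0 (Nat.zero_le _))
    (by
      intro R hR t i
      rcases lt_or_ge t (T R) with ht | ht
      · rw [P_le R _ ht, P_le R _ ht.le]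
        exact copsAt_valid σ R t i
      · obtain ⟨u, rfl⟩ := Nat.exists_eq_add_of_le ht
        rw [add_assoc, P_add R hR, P_add R hR]
        exact copsAt_valid _ _ u i)
    (by
      intro R hR R' hR' t _ ho
      rcases le_total (T R) (T R') with hle | hle
      · exact key R hR R' hR' t ho hle
      · exact (key R' hR' R hR t
          ⟨fun s hs => (ho.1 s hs).symm, fun s hs => (ho.2 s hs).symm⟩ hle).symm)
  refine ⟨σ', h0, fun R hR => ?_⟩
  obtain ⟨u, i, hu⟩ := (hT R hR R hR rfl).2
  refine ⟨T R + u, i, ?_⟩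
  rw [hσ' R hR, hσ' R hR, add_assoc, P_add R hR, P_add R hR]
  exact hu

/-- A step along a shortest path. -/
lemma exists_step (hG : G.Connected) (a b : V) :
    ∃ c, (c = a ∨ G.Adj a c) ∧ G.dist c b ≤ G.dist a b - 1 := by
  obtain ⟨w, hw⟩ := (hG a b).exists_walk_length_eq_dist
  cases w with
  | nil => exact ⟨a, Or.inl rfl, by simp⟩
  | cons h w =>
    refine ⟨_, Or.inr h, ?_⟩
    rw [← hw, SimpleGraph.Walk.length_cons]
    exact SimpleGraph.dist_le w

lemma Captures.pos {σ : CopStrategy G k} {R : ℕ → V} (h : Captures G ℓ σ R) : 0 < k := by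
  obtain ⟨-, i, -⟩ := h
  exact i.pos

lemma Sees.pos {σ : CopStrategy G k} {R : ℕ → V} (h : Sees G ℓ σ R) : 0 < k := by
  obtain ⟨-, i, -⟩ := h
  exact i.pos

lemma robberWalk_const (v : V) : RobberWalk G fun _ => v := fun _ => Or.inl rfl

/-- With full information, one cop can stay within distance `n` of the robber while the
others play a strategy that wins the classical game. -/
lemma exists_tracking_plan [Finite V] (hG : G.Connected) {c n : ℕ} (hn : 1 ≤ n)
    (σ : CopStrategy G c) (hσ : ∀ R, RobberWalk G R → Captures G ⊤ σ R) (hk : c + 1 ≤ k)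
    (p : Fin k → V) (i : Fin k) (r : V) (hr : G.dist (p i) r ≤ n) :
    ∃ Q : (ℕ → V) → ℕ → Fin k → V, (∀ R, Q R 0 = p) ∧
      (∀ R t j, Q R (t + 1) j = Q R t j ∨ G.Adj (Q R t j) (Q R (t + 1) j)) ∧
      (∀ R R' t, (∀ s ≤ t, R s = R' s) → Q R (t + 1) = Q R' (t + 1)) ∧
      ∀ R, RobberWalk G R → R 0 = r → (∀ t, G.dist (Q R t i) (R t) ≤ n) ∧
        ∃ t j, Q R t j = R t ∨ Q R (t + 1) j = R t := by
  classical
  choose next next_valid dist_next using exists_step hG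
  have hc : 0 < c := (hσ _ (robberWalk_const r)).pos
  obtain ⟨g, hg⟩ : ∃ g : Fin k → Fin c, ∀ a, ∃ j, j ≠ i ∧ g j = a := by
    obtain ⟨m, rfl⟩ : ∃ m, k = m + 1 := ⟨k - 1, by omega⟩
    have : Nonempty (Fin c) := ⟨⟨0, hc⟩⟩
    have hinj : Function.Injective fun a : Fin c =>
        i.succAbove (Fin.castLE (Nat.le_of_succ_le_succ hk) a) :=
      Fin.succAbove_right_injective.comp (Fin.castLE_injective _)
    exact ⟨Function.invFun _, fun a =>
      ⟨_, Fin.succAbove_ne _ _, Function.leftInverse_invFun hinj a⟩⟩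
  obtain ⟨N, hN⟩ : ∃ N, ∀ a b, G.dist a b ≤ N := by
    obtain ⟨N, hN⟩ := (Set.finite_range fun x : V × V => G.dist x.1 x.2).bddAbove
    exact ⟨N, fun a b => hN ⟨(a, b), rfl⟩⟩
  let tracker : (ℕ → V) → ℕ → V := fun R t => Nat.rec (p i) (fun s q => next q (R s)) t
  let approach : Fin k → ℕ → V := fun j t =>
    Nat.rec (p j) (fun _ q => next q (σ.init (g j))) t
  have approach_dist : ∀ j t, G.dist (approach j t) (σ.init (g j)) ≤ N - t := by
    intro j t
    induction t with
    | zero => exact hN _ _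
    | succ t ih =>
      have : G.dist (approach j (t + 1)) _ ≤ _ := dist_next (approach j t) (σ.init (g j))
      omega
  have approach_N : ∀ j, approach j N = σ.init (g j) := by
    intro j
    have := approach_dist j N
    exact hG.dist_eq_zero_iff.1 (by omega)
  let Q : (ℕ → V) → ℕ → Fin k → V := fun R t j =>
    if j = i then tracker R t
    else if t ≤ N then approach j t
    else copsAt G ⊤ σ (fun u => R (N + u)) (t - N) (g j)
  have Q_tracker : ∀ R t, Q R t i = tracker R t := fun R t => if_pos rfl
  have Q_approach : ∀ R t j, j ≠ i → t ≤ N → Q R t j = approach j t := by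
    intro R t j hj ht
    simp only [Q, if_neg hj, if_pos ht]
  have Q_add : ∀ R u j, j ≠ i →
      Q R (N + u) j = copsAt G ⊤ σ (fun u => R (N + u)) u (g j) := by
    intro R u j hj
    cases u with
    | zero =>
      rw [add_zero, Q_approach R N j hj le_rfl, approach_N]
      rfl
    | succ u =>
      simp only [Q, if_neg hj]
      rw [if_neg (by omega), Nat.add_sub_cancel_left]
  have tracker_congr : ∀ R R' t, (∀ s < t, R s = R' s) → tracker R t = tracker R' t := by
    intro R R' t
    induction t with
    | zero => intro _; rfl
    | succ t ih =>
      intro h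
      change next (tracker R t) (R t) = next (tracker R' t) (R' t)
      rw [ih fun s hs => h s (by omega), h t (by omega)]
  refine ⟨Q, fun R => ?_, fun R t j => ?_, fun R R' t h => ?_, fun R hR hR0 => ⟨?_, ?_⟩⟩
  · funext j
    by_cases hj : j = i
    · rw [hj]
      exact Q_tracker R 0
    · exact Q_approach R 0 j hj (Nat.zero_le _)
  · by_cases hj : j = i
    · rw [hj, Q_tracker R t, Q_tracker R (t + 1)]
      exact next_valid _ _
    · rcases lt_or_ge t N with ht | ht
      · rw [Q_approach R _ j hj ht, Q_approach R _ j hj ht.le]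
        exact next_valid _ _
      · obtain ⟨u, rfl⟩ := Nat.exists_eq_add_of_le ht
        rw [add_assoc, Q_add R _ j hj, Q_add R _ j hj]
        exact copsAt_valid _ _ _ _
  · funext j
    by_cases hj : j = i
    · rw [hj, Q_tracker R (t + 1), Q_tracker R' (t + 1)]
      exact tracker_congr R R' (t + 1) fun s hs => h s (by omega)
    · rcases lt_or_ge t N with ht | ht
      · rw [Q_approach R _ j hj ht, Q_approach R' _ j hj ht]
      · obtain ⟨u, rfl⟩ := Nat.exists_eq_add_of_le ht
        rw [add_assoc, Q_add R _ j hj, Q_add R' _ j hj]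
        have := play_congr (G := G) (ℓ := ⊤) σ (R := fun u => R (N + u))
          (R' := fun u => R' (N + u)) (t := u) fun s hs => h _ (by omega)
        simp only [copsAt, play, this]
  · intro t
    rw [Q_tracker]
    induction t with
    | zero => rw [hR0]; exact hr
    | succ t ih =>
      have h1 : G.dist (tracker R (t + 1)) (R t) ≤ _ := dist_next (tracker R t) (R t)
      have h2 := hR.dist_succ_le_one t
      have h3 := hG.dist_triangle (u := tracker R (t + 1)) (v := R t) (w := R (t + 1))
      omega
  · obtain ⟨u, a, hu⟩ := hσ _ (hR.shift N)
    obtain ⟨j, hj, rfl⟩ := hg a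
    refine ⟨N + u, j, ?_⟩
    rw [add_assoc, Q_add R _ j hj, Q_add R _ j hj]
    exact hu

/-- If the robber is visible at the end of a round, then `c(G) + 1` cops capture him. -/
lemma exists_capturing_of_visible [Finite V] (hG : G.Connected) {c n : ℕ} (hn : 1 ≤ n)
    (σ : CopStrategy G c) (hσ : ∀ R, RobberWalk G R → Captures G ⊤ σ R) (hk : c + 1 ≤ k)
    (p : Fin k → V) (i : Fin k) (r : V) (hr : G.dist (p i) r ≤ n) :
    ∃ τ : CopStrategy G k, τ.init = p ∧
      ∀ R, RobberWalk G R → R 0 = r → Captures G (n : ℕ∞) τ R := by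
  obtain ⟨Q, h0, hv, hd, hw⟩ := exists_tracking_plan hG hn σ hσ hk p i r hr
  obtain ⟨τ, hτ0, hτ⟩ := exists_strategy (G := G) (ℓ := n) {R | RobberWalk G R ∧ R 0 = r} Q p
    (fun R _ => h0 R) (fun R _ => hv R) (by
      intro R hR R' _ t hQ ho
      refine hd R R' t fun s hs => ?_
      refine eq_of_obs_eq (G := G) (ℓ := n) (p := Q R s) (i := i)
        (by exact_mod_cast (hw R hR.1 hR.2).1 s) ?_
      rw [ho.1 s hs, hQ s hs])
  refine ⟨τ, hτ0, fun R hR hR0 => ?_⟩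
  obtain ⟨t, j, h⟩ := (hw R hR hR0).2
  refine ⟨t, j, ?_⟩
  rw [hτ R ⟨hR, hR0⟩, hτ R ⟨hR, hR0⟩]
  exact h

/-- If the robber is known to be within one step of a vertex `r` in the range of some cop, then
`c(G) + 1` cops capture him: chasing the robber's previous position makes him visible at the
end of a round. -/
lemma exists_capturing_of_near_visible [Finite V] (hG : G.Connected) {c n : ℕ} (hn : 2 ≤ n)
    (σ : CopStrategy G c) (hσ : ∀ R, RobberWalk G R → Captures G ⊤ σ R) (hk : c + 1 ≤ k)
    (p : Fin k → V) (i : Fin k) (r : V) (hr : G.dist (p i) r ≤ n) :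
    ∃ τ : CopStrategy G k, τ.init = p ∧
      ∀ R, RobberWalk G R → (R 0 = r ∨ G.Adj r (R 0)) → Captures G (n : ℕ∞) τ R := by
  obtain ⟨Q, h0, hv, hd, hw⟩ := exists_tracking_plan hG (by omega) σ hσ hk p i r hr
  let D : (ℕ → V) → ℕ → V := fun R t => Nat.casesOn t r R
  have walk_D : ∀ R, RobberWalk G R → (R 0 = r ∨ G.Adj r (R 0)) → RobberWalk G (D R) := by
    intro R hR hR0 t
    cases t with
    | zero => exact hR0
    | succ t => exact hR t
  obtain ⟨τ, hτ0, hτ⟩ := exists_strategy (G := G) (ℓ := n)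
    {R | RobberWalk G R ∧ (R 0 = r ∨ G.Adj r (R 0))} (fun R => Q (D R)) p
    (fun R _ => h0 _) (fun R _ => hv _) (by
      intro R hR R' _ t hQ ho
      refine hd _ _ t fun s hs => ?_
      cases s with
      | zero => rfl
      | succ s =>
        refine eq_of_obs_eq (G := G) (ℓ := n) (p := Q (D R) (s + 1)) (i := i)
          (by exact_mod_cast (hw _ (walk_D R hR.1 hR.2) rfl).1 (s + 1)) ?_
        refine (ho.2 s hs).trans ?_
        rw [← hQ (s + 1) hs])
  obtain ⟨τ', hτ'0, hτ'⟩ := exists_capturing_of_switch (ℓ := n) τ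
    {R | RobberWalk G R ∧ (R 0 = r ∨ G.Adj r (R 0))} (by
      intro R hR
      obtain ⟨t, j, ht⟩ : ∃ t j, G.dist (copsAt G n τ R t j) (R t) ≤ n := by
        have hD := walk_D R hR.1 hR.2
        obtain ⟨t, j, h⟩ := (hw _ hD rfl).2
        have h1 : G.dist (D R t) (R t) ≤ 1 := hD.dist_succ_le_one t
        rcases h with h | h
        · refine ⟨t, j, ?_⟩
          rw [hτ R hR, h]
          omega
        · refine ⟨t + 1, j, ?_⟩
          rw [hτ R hR, h]
          have h2 := hR.1.dist_succ_le_one t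
          have h3 := hG.dist_triangle (u := D R t) (v := R t) (w := R (t + 1))
          omega
      obtain ⟨ρ, hρ0, hρ⟩ := exists_capturing_of_visible hG (by omega) σ hσ hk
        (copsAt G n τ R t) j (R t) ht
      refine ⟨t, ρ, fun R' hR' ho => ?_⟩
      have hc := (copsAt_eq_of_obsAgree τ ho).1
      refine ⟨hρ0.trans hc, hρ _ (hR'.1.shift t) ?_⟩
      refine (eq_of_obs_eq (G := G) (ℓ := n) (p := copsAt G n τ R t) (i := j)
        (by exact_mod_cast ht) ?_).symm
      rw [ho.1 t le_rfl, hc]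
      rfl)
  exact ⟨τ', hτ'0.trans hτ0, fun R hR hR0 => hτ' R ⟨hR, hR0⟩⟩

/-- Surplus cops do not hinder seeing the robber. -/
lemma exists_seeing_of_le {m : ℕ} (hm : 0 < m) (hk : m ≤ k) (σ : CopStrategy G m)
    (hσ : ∀ R, RobberWalk G R → Sees G ℓ σ R) :
    ∃ σ' : CopStrategy G k, ∀ R, RobberWalk G R → Sees G ℓ σ' R := by
  obtain ⟨g, hg⟩ : ∃ g : Fin k → Fin m, Function.Surjective g := by
    have : Nonempty (Fin m) := ⟨⟨0, hm⟩⟩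
    exact ⟨_, Function.invFun_surjective (Fin.castLE_injective hk)⟩
  have hobs : ∀ (p : Fin m → V) r, obs G ℓ (fun j => p (g j)) r = obs G ℓ p r := by
    intro p r
    simp only [obs, hg.exists]
  obtain ⟨σ', -, hσ'⟩ := exists_strategy (G := G) (ℓ := ℓ) Set.univ
    (fun R t j => copsAt G ℓ σ R t (g j)) (fun j => σ.init (g j)) (fun R _ => rfl)
    (fun R _ t j => copsAt_valid σ R t (g j)) (by
      intro R _ R' _ t _ ho
      simp only [ObsAgree, hobs] at ho
      rw [(copsAt_eq_of_obsAgree σ ho).2])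
  refine ⟨σ', fun R hR => ?_⟩
  obtain ⟨t, a, h⟩ := hσ R hR
  obtain ⟨j, rfl⟩ := hg a
  refine ⟨t, j, ?_⟩
  rw [hσ' R trivial, hσ' R trivial]
  exact h

/-- Full visibility is at least as good for the cops as limited visibility. -/
lemma exists_capturing_top [Nonempty V] (σ : CopStrategy G k)
    (hσ : ∀ R, RobberWalk G R → Captures G ℓ σ R) :
    ∃ σ' : CopStrategy G k, ∀ R, RobberWalk G R → Captures G ⊤ σ' R := by
  have hk : 0 < k := (hσ _ (robberWalk_const (Classical.arbitrary V))).pos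
  obtain ⟨σ', -, hσ'⟩ := exists_strategy (G := G) (ℓ := ⊤) Set.univ
    (fun R t => copsAt G ℓ σ R t) σ.init (fun R _ => rfl)
    (fun R _ t j => copsAt_valid σ R t j) (by
      intro R _ R' _ t hP ho
      have : play G ℓ σ R t = play G ℓ σ R' t := play_congr σ fun s hs => by
        refine eq_of_obs_eq (G := G) (ℓ := ⊤) (p := copsAt G ℓ σ R s) (i := ⟨0, hk⟩) le_top ?_
        rw [ho.1 s hs, hP s hs]
      simp only [copsAt, play, this])
  refine ⟨σ', fun R hR => ?_⟩
  obtain ⟨t, j, h⟩ := hσ R hR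
  refine ⟨t, j, ?_⟩
  rw [hσ' R trivial, hσ' R trivial]
  exact h

lemma Captures.sees {σ : CopStrategy G k} {R : ℕ → V} (h : Captures G ℓ σ R) :
    Sees G ℓ σ R := by
  obtain ⟨t, i, h | h⟩ := h
  · exact ⟨t, i, Or.inl (by simp [h])⟩
  · exact ⟨t, i, Or.inr (by simp [h])⟩

/-- Cops occupying every vertex capture the robber at once. -/
lemma exists_capturing [Finite V] (G : SimpleGraph V) (ℓ : ℕ∞) :
    ∃ k, ∃ σ : CopStrategy G k, ∀ R, RobberWalk G R → Captures G ℓ σ R := by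
  obtain ⟨k, ⟨e⟩⟩ := Finite.exists_equiv_fin V
  refine ⟨k, ⟨e.symm, fun _ p => p, fun _ _ _ => Or.inl rfl⟩, fun R _ => ⟨0, e (R 0), Or.inl ?_⟩⟩
  simp [copsAt, play]

/-- `max (c'_ℓ(G)) (c(G) + 1)` cops suffice: after the robber has first been seen, one cop keeps
track of him while the others play the classical game. -/
lemma exists_capturing_of_seeing [Finite V] (hG : G.Connected) {c n : ℕ} (hn : 2 ≤ n)
    (σ : CopStrategy G c) (hσ : ∀ R, RobberWalk G R → Captures G ⊤ σ R) (hk : c + 1 ≤ k)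
    (ρ : CopStrategy G k) (hρ : ∀ R, RobberWalk G R → Sees G (n : ℕ∞) ρ R) :
    ∃ τ : CopStrategy G k, ∀ R, RobberWalk G R → Captures G (n : ℕ∞) τ R := by
  obtain ⟨τ, -, hτ⟩ := exists_capturing_of_switch (ℓ := n) ρ {R | RobberWalk G R} (by
    intro R hR
    obtain ⟨t, i, h | h⟩ := hρ R hR
    · obtain ⟨τ, hτ0, hτ⟩ := exists_capturing_of_near_visible hG hn σ hσ hk
        (copsAt G n ρ R t) i (R t) (by exact_mod_cast h)
      refine ⟨t, τ, fun R' hR' ho => ?_⟩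
      have hc := (copsAt_eq_of_obsAgree ρ ho).1
      refine ⟨hτ0.trans hc, hτ _ (RobberWalk.shift hR' t) (Or.inl ?_)⟩
      refine (eq_of_obs_eq (p := copsAt G n ρ R t) h ?_).symm
      rw [ho.1 t le_rfl, hc]
      rfl
    · obtain ⟨τ, hτ0, hτ⟩ := exists_capturing_of_near_visible hG hn σ hσ hk
        (copsAt G n ρ R (t + 1)) i (R t) (by exact_mod_cast h)
      refine ⟨t + 1, τ, fun R' hR' ho => ?_⟩
      have hc := (copsAt_eq_of_obsAgree ρ ho).1
      refine ⟨hτ0.trans hc, hτ _ (RobberWalk.shift hR' (t + 1)) ?_⟩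
      have : R t = R' t := eq_of_obs_eq h (by rw [ho.2 t t.lt_succ_self, hc])
      rw [this]
      exact hR' t)
  exact ⟨τ, hτ⟩

end Helpers

end CopsRobber

open CopsRobber in
/-- for any connected graph `G` and `ℓ ≥ 2`, either `c'_ℓ(G) = c_ℓ(G)` or
`c(G) ≤ c_ℓ(G) ≤ c(G) + 1`. -/
theorem visSeeNumber_eq_or_close {V : Type*} [Fintype V] (G : SimpleGraph V)
    (hG : G.Connected) (ℓ : ℕ) (hℓ : 2 ≤ ℓ) :
    visSeeNumber G (ℓ : ℕ∞) = visCopNumber G (ℓ : ℕ∞) ∨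
      (copNumber G ≤ visCopNumber G (ℓ : ℕ∞) ∧
        visCopNumber G (ℓ : ℕ∞) ≤ copNumber G + 1) := by
  have := hG.nonempty
  obtain ⟨σ, hσ⟩ : ∃ σ : CopStrategy G (copNumber G),
      ∀ R, RobberWalk G R → Captures G ⊤ σ R := Nat.sInf_mem (exists_capturing G ⊤)
  obtain ⟨τ, hτ⟩ : ∃ τ : CopStrategy G (visCopNumber G ℓ),
      ∀ R, RobberWalk G R → Captures G ℓ τ R := Nat.sInf_mem (exists_capturing G ℓ)
  have hτ' : ∀ R, RobberWalk G R → Sees G ℓ τ R := fun R hR => (hτ R hR).sees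
  obtain ⟨ρ, hρ⟩ : ∃ ρ : CopStrategy G (visSeeNumber G ℓ),
      ∀ R, RobberWalk G R → Sees G ℓ ρ R :=
    Nat.sInf_mem (s := {k | ∃ σ : CopStrategy G k, ∀ R, RobberWalk G R → Sees G ℓ σ R})
      ⟨_, τ, hτ'⟩
  have see_le : visSeeNumber G ℓ ≤ visCopNumber G ℓ := Nat.sInf_le ⟨τ, hτ'⟩
  have cop_le : copNumber G ≤ visCopNumber G ℓ := Nat.sInf_le (exists_capturing_top τ hτ)
  have le_max : visCopNumber G ℓ ≤ max (visSeeNumber G ℓ) (copNumber G + 1) := by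
    have hpos := (hρ _ (robberWalk_const (Classical.arbitrary V))).pos
    obtain ⟨ρ', hρ'⟩ := exists_seeing_of_le hpos
      (le_max_left (visSeeNumber G ℓ) (copNumber G + 1)) ρ hρ
    exact Nat.sInf_le (exists_capturing_of_seeing hG hℓ σ hσ (le_max_right _ _) ρ' hρ')
  omega
end
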